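/- For every n ≥ 2, the map ζ_D* : L_{n−1,n} → B_{2n−1} defined by ζ_D*(π*) = (ζ_D(π))* for π ∈ L•_{n−1,n} is well defined (i.e. (ζ_D(π))* depends only on π*) and is a bijection from lattice paths with n−1 East steps and n North steps onto ballot paths with 2n−1 steps. -/

import Mathlib

inductive Step
  | N : Step
  | E : Step
  deriving DecidableEq

/-- The number of East steps strictly preceding the `k`-th North step. -/
def ebn : List Step → ℕ → ℕ
  | _, 0 => 0
  | [], _ + 1 => 0
  | Step.E :: rest, k + 1 => ebn rest (k + 1) + 1
  | Step.N :: rest, k + 1 => ebn rest k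

/-- A lattice path with `a` East steps and `b` North steps. -/
def IsLatticePath (a b : ℕ) (π : List Step) : Prop :=
  π.count Step.E = a ∧ π.count Step.N = b

/-- A ballot path of length `m`: every prefix has at least as many `N`s as `E`s. -/
def IsBallotPath (m : ℕ) (β : List Step) : Prop :=
  β.length = m ∧ ∀ k : ℕ, (β.take k).count Step.E ≤ (β.take k).count Step.N

/-- `i` is a rise: the `i`-th North step is immediately followed by a North step. -/
def IsRise (π : List Step) (i : ℕ) : Prop :=
  ∃ p : ℕ, π[p]? = some Step.N ∧ π[p + 1]? = some Step.N ∧ (π.take p).count Step.N + 1 = i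

/-- `(i,j)` is a valley: the `i`-th East step is immediately followed by the `j`-th North
step; in addition if the path ends with an East step and consists of `i` East steps and
`j - 1` North steps, then `(i, j)` counts as a valley. -/
def IsValley (β : List Step) (i j : ℕ) : Prop :=
  (∃ p : ℕ, β[p]? = some Step.E ∧ β[p + 1]? = some Step.N ∧
      (β.take p).count Step.E + 1 = i ∧ (β.take (p + 1)).count Step.N + 1 = j) ∨
  (β.getLast? = some Step.E ∧ i = β.count Step.E ∧ j = β.count Step.N + 1)

/-- Read `a` from left to right, writing `N` for each entry `j` and `E` for each entry `j+1`. -/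
def sPlusL (j : ℤ) (a : List ℤ) : List Step :=
  a.filterMap fun x => if x = j then some Step.N else if x = j + 1 then some Step.E else none

/-- Read `a` from right to left, writing `N` for each entry `j` and `E` for each entry `j+1`. -/
def sPlusR (j : ℤ) (a : List ℤ) : List Step := sPlusL j a.reverse

/-- Read `a` from left to right, writing `N` for each entry `-j` and `E` for each entry `-j-1`. -/
def sMinusL (j : ℤ) (a : List ℤ) : List Step :=
  a.filterMap fun x => if x = -j then some Step.N else if x = -j - 1 then some Step.E else none

/-- Read `a` from right to left, writing `N` for each entry `-j` and `E` for each entry `-j-1`. -/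
def sMinusR (j : ℤ) (a : List ℤ) : List Step := sMinusL j a.reverse

/-- A possibly signed path: a path together with a sign `ε ∈ {1, -1}` carried by the
distinguished signed East step (the sign is `1` whenever there is no signed step). -/
structure SPath where
  path : List Step
  sgn : ℤ

/-- The `k`-th North step is immediately followed by an East step. -/
def NthNFollowedByE (β : List Step) (k : ℕ) : Prop :=
  ∃ p : ℕ, β[p]? = some Step.N ∧ (β.take p).count Step.N + 1 = k ∧ β[p + 1]? = some Step.E

/-- Signed lattice paths `L•_{n-1,n}`: the first step may carry a sign if it is an East step. -/
def IsSignedLatticePath (n : ℕ) (π : SPath) : Prop :=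
  IsLatticePath (n - 1) n π.path ∧ (π.sgn = 1 ∨ π.sgn = -1) ∧
    (π.path.head? = some Step.N → π.sgn = 1)

/-- Signed ballot paths `B•_{2n-1}`: the East step following the `n`-th North step (if any)
may carry a sign. -/
def IsSignedBallotPath (n : ℕ) (β : SPath) : Prop :=
  IsBallotPath (2 * n - 1) β.path ∧ (β.sgn = 1 ∨ β.sgn = -1) ∧
    (¬ NthNFollowedByE β.path n → β.sgn = 1)

/-- The vector `λ(π)` of a signed lattice path (1-based index). -/
def lamD (n : ℕ) (π : SPath) (i : ℕ) : ℤ :=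
  if i = 1 then π.sgn * (ebn π.path 1 : ℤ)
  else if i = n then
    (if (∑ k ∈ Finset.Icc 1 (n - 2), ebn π.path k) % 2 = 0 then
        2 * (ebn π.path n : ℤ) - (ebn π.path (n - 1) : ℤ)
      else 2 * (n : ℤ) - 1 - 2 * (ebn π.path n : ℤ) + (ebn π.path (n - 1) : ℤ))
  else (ebn π.path i : ℤ)

/-- The type `Dₙ` area vector (1-based index). -/
def areaD (n : ℕ) (π : SPath) (i : ℕ) : ℤ :=
  if i = 1 then
    (if (n - 1) % 4 = 0 ∨ (n - 1) % 4 = 3 then lamD n π 1 else -lamD n π 1)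
  else if i = n then
    (if (n - 1) % 4 = 0 ∨ (n - 1) % 4 = 3 then lamD n π n - ((n : ℤ) - 1)
      else (n : ℤ) - lamD n π n)
  else lamD n π i - ((i : ℤ) - 1)

def areaDList (n : ℕ) (π : SPath) : List ℤ :=
  (List.range n).map fun k => areaD n π (k + 1)

/-- The underlying (unsigned) path of the image of the type `Dₙ` zeta map. -/
def zetaDraw (n : ℕ) (π : SPath) : List Step :=
  (((List.range (2 * n)).reverse.map (fun j =>
    sMinusR (j : ℤ) (areaDList n π) ++ sPlusL (j : ℤ) (areaDList n π))).flatten).dropLast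

-- The type `Dₙ` zeta map on signed lattice paths.
open scoped Classical in
noncomputable def zetaD (n : ℕ) (π : SPath) : SPath where
  path := zetaDraw n π
  sgn :=
    if NthNFollowedByE (zetaDraw n π) n then
      (if ((Finset.Icc 1 n).filter (fun r => 0 < areaD n π r)).card % 2 = 0 then 1 else -1)
    else 1

/-- The concatenation `S (i + m - 1) ⋯ S (i + 1) S i` of a family of words, highest level first. -/
def descend (S : ℤ → List Step) (i : ℤ) : ℕ → List Step
  | 0 => []
  | m + 1 => descend S (i + 1) m ++ S i

/-- The antisymmetric sequence `-aₙ, …, -a₁, a₁, …, aₙ`. -/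
def antisymmDouble (a : List ℤ) : List ℤ := (a.reverse.map fun x => -x) ++ a

/-- Each entry drops by at most one from its predecessor. -/
def SlowDescent (W : List ℤ) : Prop := W.IsChain fun a b => a - 1 ≤ b

/-! ### Words of a fixed level -/

lemma sPlusL_append (j : ℤ) (a b : List ℤ) : sPlusL j (a ++ b) = sPlusL j a ++ sPlusL j b := by
  simp [sPlusL]

lemma sPlusL_cons (j x : ℤ) (a : List ℤ) :
    sPlusL j (x :: a) =
      (if x = j then [Step.N] else if x = j + 1 then [Step.E] else []) ++ sPlusL j a := by
  unfold sPlusL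
  rw [List.filterMap_cons]
  split_ifs <;> simp_all

lemma sPlusL_nil (j : ℤ) : sPlusL j [] = [] := rfl

lemma sPlusL_eq_nil {j : ℤ} {W : List ℤ} (h : ∀ a ∈ W, a < j) : sPlusL j W = [] := by
  unfold sPlusL
  rw [List.filterMap_eq_nil_iff]
  intro a ha
  have := h a ha
  rw [if_neg (by omega), if_neg (by omega)]

lemma sMinusR_append_sPlusL (j : ℤ) (a : List ℤ) :
    sMinusR j a ++ sPlusL j a = sPlusL j (antisymmDouble a) := by
  rw [antisymmDouble, sPlusL_append]
  congr 1
  unfold sMinusR sMinusL sPlusL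
  rw [List.filterMap_map]
  congr 1
  funext x
  have h1 : (-x = j) ↔ (x = -j) := by omega
  have h2 : (-x = j + 1) ↔ (x = -j - 1) := by omega
  simp [h1, h2]

lemma count_N_sPlusL (j : ℤ) (W : List ℤ) : (sPlusL j W).count Step.N = W.count j := by
  induction W with
  | nil => rfl
  | cons a W ih =>
    rw [sPlusL_cons, List.count_append, ih, List.count_cons]
    split_ifs <;> simp_all
    omega

lemma count_E_sPlusL (j : ℤ) (W : List ℤ) : (sPlusL j W).count Step.E = W.count (j + 1) := by
  induction W with
  | nil => rfl
  | cons a W ih =>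
    rw [sPlusL_cons, List.count_append, ih, List.count_cons]
    split_ifs <;> simp_all
    omega

lemma length_eq_count_add_count (w : List Step) :
    w.length = w.count Step.N + w.count Step.E := by
  induction w with
  | nil => rfl
  | cons s w ih => cases s <;> simp [ih] <;> omega

lemma sPlusL_getLast {W : List ℤ} (hW : SlowDescent W) {j : ℤ}
    (hlast : ∀ a ∈ W.getLast?, a ≤ j) :
    (sPlusL j W).getLast? = some Step.N ∨ ∀ a ∈ W, a < j := by
  induction W with
  | nil => simp
  | cons a W ih =>
    cases W with
    | nil =>
      simp only [List.getLast?_singleton, Option.mem_def, Option.some.injEq, forall_eq'] at hlast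
      rcases hlast.lt_or_eq with h | h
      · right; simpa using h
      · left; simp [sPlusL_cons, sPlusL_nil, h]
    | cons b W =>
      rw [SlowDescent, List.isChain_cons_cons] at hW
      rw [List.getLast?_cons_cons] at hlast
      rcases ih hW.2 hlast with h | h
      · left
        rw [sPlusL_cons, List.getLast?_append, h]
        rfl
      · have hb := h b (by simp)
        have hab := hW.1
        rcases (show a ≤ j by omega).lt_or_eq with ha | ha
        · right
          intro c hc
          rcases List.mem_cons.1 hc with rfl | hc
          · exact ha
          · exact h c hc
        · left
          have : sPlusL j (b :: W) = [] := sPlusL_eq_nil h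
          rw [sPlusL_cons, this]
          simp [ha]

lemma sPlusL_head_ne {W : List ℤ} (hW : SlowDescent W) {j : ℤ}
    (hhead : ∀ a ∈ W.head?, j < a) : (sPlusL j W).head? ≠ some Step.N := by
  induction W with
  | nil => simp [sPlusL_nil]
  | cons a W ih =>
    simp only [List.head?_cons, Option.mem_def, Option.some.injEq, forall_eq'] at hhead
    rw [SlowDescent, List.isChain_cons] at hW
    rw [sPlusL_cons, if_neg (by omega)]
    split_ifs with h
    · simp
    · refine ih hW.2 fun b hb => ?_
      have := hW.1 b hb
      omega

/-- A slowly descending sequence is determined by the relative order of its entries of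
consecutive values. -/
lemma SlowDescent.ext {W V : List ℤ} (hW : SlowDescent W) (hV : SlowDescent V)
    (h : ∀ j, sPlusL j W = sPlusL j V) : W = V := by
  have key : ∀ {a : ℤ} {A B : List ℤ}, SlowDescent B → sPlusL a (a :: A) = sPlusL a B →
      ∃ b ∈ B.head?, b ≤ a := by
    intro a A B hB hAB
    by_contra! hcon
    refine sPlusL_head_ne hB hcon ?_
    rw [← hAB, sPlusL_cons]
    simp
  induction W generalizing V with
  | nil =>
    cases V with
    | nil => rfl
    | cons v V =>
      obtain ⟨b, hb, -⟩ := key hW (h v).symm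
      simp at hb
  | cons w W ih =>
    obtain ⟨b, hb, hbw⟩ := key hV (h w)
    cases V with
    | nil => simp at hb
    | cons v V =>
      obtain ⟨c, hc, hcv⟩ := key hW (h v).symm
      simp only [List.head?_cons, Option.mem_def, Option.some.injEq] at hb hc
      obtain rfl : w = v := by omega
      congr 1
      refine ih (List.isChain_cons.1 hW).2 (List.isChain_cons.1 hV).2 fun j => ?_
      have := h j
      rw [sPlusL_cons, sPlusL_cons] at this
      exact List.append_cancel_left this

/-! ### Antisymmetric sequences -/

lemma antisymmDouble_append_singleton (a : List ℤ) (v : ℤ) :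
    antisymmDouble (a ++ [v]) = -v :: (antisymmDouble a ++ [v]) := by
  simp [antisymmDouble]

lemma antisymmDouble_reverse_neg (a : List ℤ) :
    ((antisymmDouble a).reverse.map fun x => -x) = antisymmDouble a := by
  simp [antisymmDouble, ← List.map_reverse]

lemma sPlusL_reverse_neg (j : ℤ) (W : List ℤ) :
    sPlusL j (W.reverse.map fun x => -x) =
      (sPlusL (-j - 1) W).reverse.map fun s => if s = Step.N then Step.E else Step.N := by
  induction W with
  | nil => rfl
  | cons a W ih =>
    rw [List.reverse_cons, List.map_append, sPlusL_append, ih, sPlusL_cons (-j - 1) a W,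
      List.reverse_append, List.map_append]
    congr 1
    simp only [List.map_cons, List.map_nil, sPlusL_cons, sPlusL_nil, List.append_nil]
    split_ifs <;> first | omega | simp

lemma antisymmDouble_slowDescent {a : List ℤ} (ha : SlowDescent a) (hhead : ∀ x ∈ a.head?, 0 ≤ x) :
    SlowDescent (antisymmDouble a) := by
  unfold antisymmDouble SlowDescent
  rw [List.isChain_append]
  refine ⟨?_, ha, ?_⟩
  · rw [List.isChain_map, List.isChain_reverse]
    refine ha.imp fun x y hxy => ?_
    change x - 1 ≤ y at hxy
    omega
  · intro x hx y hy
    have := hhead y hy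
    simp only [List.getLast?_map, List.getLast?_reverse, Option.mem_def, Option.map_eq_some_iff]
      at hx
    obtain ⟨z, hz, rfl⟩ := hx
    have := hhead z hz
    omega

lemma antisymmDouble_injective_of_sPlusL {a b : List ℤ} (ha : SlowDescent (antisymmDouble a))
    (hb : SlowDescent (antisymmDouble b))
    (h : ∀ j, 0 ≤ j → sPlusL j (antisymmDouble a) = sPlusL j (antisymmDouble b)) : a = b := by
  have heq : antisymmDouble a = antisymmDouble b := by
    refine ha.ext hb fun j => ?_
    rcases le_or_gt 0 j with hj | hj
    · exact h j hj
    · rw [← antisymmDouble_reverse_neg a, ← antisymmDouble_reverse_neg b, sPlusL_reverse_neg,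
        sPlusL_reverse_neg, h _ (by omega)]
  have hlen : a.length = b.length := by
    have := congrArg List.length heq
    simp only [antisymmDouble, List.length_append, List.length_map, List.length_reverse] at this
    omega
  exact (List.append_inj heq (by simp [hlen])).2

/-! ### The concatenated word -/

lemma descend_congr {S T : ℤ → List Step} {i : ℤ} (m : ℕ) (h : ∀ j, i ≤ j → S j = T j) :
    descend S i m = descend T i m := by
  induction m generalizing i with
  | zero => rfl
  | succ m ih =>
    rw [descend, descend, ih fun j hj => h j (by omega), h i le_rfl]

lemma flatten_reverse_range_map (S : ℤ → List Step) (i : ℤ) (m : ℕ) :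
    ((List.range m).reverse.map fun j : ℕ => S (i + j)).flatten = descend S i m := by
  induction m generalizing i with
  | zero => rfl
  | succ m ih =>
    rw [descend, ← ih, List.range_succ_eq_map]
    simp [List.map_reverse, Function.comp_def, add_assoc, add_comm (1 : ℤ)]

lemma descend_append_shift (S t : ℤ → List Step) (i : ℤ) (m : ℕ) :
    t (i + m) ++ descend (fun j => S j ++ t j) i m =
      descend (fun j => t (j + 1) ++ S j) i m ++ t i := by
  induction m generalizing i with
  | zero => simp [descend]
  | succ m ih =>
    have := ih (i + 1)
    rw [show i + 1 + (m : ℤ) = i + ((m + 1 : ℕ) : ℤ) by push_cast; ring] at this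
    rw [descend, descend, ← List.append_assoc, this]
    simp

lemma descend_append_bottom (S T : ℤ → List Step) (i : ℤ) (e : List Step) (m : ℕ)
    (h : ∀ j, i < j → S j = T j) (hi : S i = T i ++ e) :
    descend S i (m + 1) = descend T i (m + 1) ++ e := by
  rw [descend, descend, hi, descend_congr m fun j hj => h j (by omega), List.append_assoc]

lemma count_descend (W : List ℤ) (i : ℤ) (m : ℕ) :
    (descend (sPlusL · W) i m).count Step.N + W.count (i + m) =
      (descend (sPlusL · W) i m).count Step.E + W.count i := by
  induction m generalizing i with
  | zero => simp [descend]
  | succ m ih =>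
    have := ih (i + 1)
    rw [show i + 1 + (m : ℤ) = i + ((m + 1 : ℕ) : ℤ) by push_cast; ring] at this
    rw [descend, List.count_append, List.count_append, count_N_sPlusL, count_E_sPlusL]
    omega

lemma count_take_descend_le {W : List ℤ} {i : ℤ} {m : ℕ} (hW : ∀ a ∈ W, a < i + m) (k : ℕ) :
    ((descend (sPlusL · W) i m).take k).count Step.E ≤
      ((descend (sPlusL · W) i m).take k).count Step.N := by
  induction m generalizing i k with
  | zero => simp [descend]
  | succ m ih =>
    have hW' : ∀ a ∈ W, a < i + 1 + m := fun a ha => by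
      have := hW a ha
      push_cast at this
      omega
    rw [descend, List.take_append, List.count_append, List.count_append]
    rcases le_total k (descend (sPlusL · W) (i + 1) m).length with hk | hk
    · rw [Nat.sub_eq_zero_of_le hk]
      simpa using ih hW' k
    · rw [List.take_of_length_le hk]
      have h1 := count_descend W (i + 1) m
      have h2 : W.count (i + 1 + m) = 0 :=
        List.count_eq_zero.2 fun hmem => lt_irrefl _ (hW' _ hmem)
      have h3 := ((sPlusL i W).take_sublist
        (k - (descend (sPlusL · W) (i + 1) m).length)).count_le Step.E
      rw [count_E_sPlusL] at h3
      omega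

lemma length_descend (W : List ℤ) (i : ℤ) (m : ℕ) :
    (descend (sPlusL · W) i m).length =
      (W.map fun a => (if i ≤ a ∧ a < i + m then 1 else 0) +
        (if i + 1 ≤ a ∧ a < i + 1 + m then 1 else 0)).sum := by
  induction m generalizing i with
  | zero =>
    refine (List.sum_eq_zero fun x hx => ?_).symm
    obtain ⟨a, -, rfl⟩ := List.mem_map.1 hx
    rw [if_neg (by push_cast; omega), if_neg (by push_cast; omega), add_zero]
  | succ m ih =>
    rw [descend, List.length_append, ih, length_eq_count_add_count, count_N_sPlusL,
      count_E_sPlusL]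
    clear ih
    induction W with
    | nil => rfl
    | cons a W ih =>
      simp only [List.map_cons, List.sum_cons, List.count_cons, beq_iff_eq] at ih ⊢
      push_cast at ih ⊢
      split_ifs <;> omega

lemma length_descend_antisymmDouble {a : List ℤ} {m : ℕ} (ha : ∀ x ∈ a, -m < x ∧ x < m) :
    (descend (sPlusL · (antisymmDouble a)) 0 m).length = 2 * a.length := by
  rw [length_descend, antisymmDouble, List.map_append, List.sum_append, List.map_map,
    List.map_reverse, List.sum_reverse]
  induction a with
  | nil => rfl
  | cons x a ih =>
    have hx := ha x (by simp)
    have := ih fun y hy => ha y (by simp [hy])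
    simp only [List.map_cons, List.sum_cons, List.length_cons, Function.comp] at this ⊢
    split_ifs <;> omega

lemma descend_getLast {W : List ℤ} (hW : SlowDescent W) {i : ℤ}
    (hlast : ∀ a ∈ W.getLast?, a ≤ i) (m : ℕ) :
    descend (sPlusL · W) i m = [] ∨ (descend (sPlusL · W) i m).getLast? = some Step.N := by
  induction m generalizing i with
  | zero => simp [descend]
  | succ m ih =>
    rw [descend]
    rcases sPlusL_getLast hW hlast with h | h
    · right
      rw [List.getLast?_append, h]
      rfl
    · have : sPlusL i W = [] := sPlusL_eq_nil h
      rw [this, List.append_nil]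
      exact ih fun a ha => (hlast a ha).trans (by omega)

/-- A factorization whose left factor ends in `N` is determined by the number of `N`s of its
right factor. -/
lemma append_inj_of_count {A B S T : List Step} (h : A ++ S = B ++ T)
    (hA : A = [] ∨ A.getLast? = some Step.N) (hB : B = [] ∨ B.getLast? = some Step.N)
    (hc : S.count Step.N = T.count Step.N) : A = B ∧ S = T := by
  have key : ∀ {A C T : List Step}, (A ++ C = [] ∨ (A ++ C).getLast? = some Step.N) →
      (C ++ T).count Step.N = T.count Step.N → C = [] := by
    intro A C T hlast hcount
    rcases hlast with h | h
    · exact (List.append_eq_nil_iff.1 h).2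
    · by_contra hC
      rw [List.getLast?_append_of_ne_nil _ hC] at h
      have := List.count_pos_iff.2 (List.mem_of_getLast? h)
      rw [List.count_append] at hcount
      omega
  rcases List.append_eq_append_iff.1 h with ⟨C, rfl, rfl⟩ | ⟨C, rfl, rfl⟩
  · obtain rfl := key hB hc
    simp
  · obtain rfl := key hA hc.symm
    simp

lemma sPlusL_eq_of_descend_eq {W V : List ℤ} (hW : SlowDescent W) (hV : SlowDescent V)
    {i : ℤ} {m : ℕ} (hWl : ∀ a ∈ W.getLast?, a ≤ i) (hVl : ∀ a ∈ V.getLast?, a ≤ i)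
    (h : descend (sPlusL · W) i m = descend (sPlusL · V) i m) (hc : W.count i = V.count i)
    {j : ℤ} (hij : i ≤ j) (hj : j < i + m) : sPlusL j W = sPlusL j V := by
  induction m generalizing i with
  | zero => push_cast at hj; omega
  | succ m ih =>
    have hWl' : ∀ a ∈ W.getLast?, a ≤ i + 1 := fun a ha => (hWl a ha).trans (by omega)
    have hVl' : ∀ a ∈ V.getLast?, a ≤ i + 1 := fun a ha => (hVl a ha).trans (by omega)
    obtain ⟨h1, h2⟩ := append_inj_of_count h (descend_getLast hW hWl' m)
      (descend_getLast hV hVl' m) (by rw [count_N_sPlusL, count_N_sPlusL, hc])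
    rcases hij.eq_or_lt with rfl | hij
    · exact h2
    · refine ih hWl' hVl' h1 ?_ hij (by push_cast at hj; omega)
      rw [← count_E_sPlusL, ← count_E_sPlusL]
      exact congrArg _ h2

/-! ### Invariance of the word under the type `D` symmetries -/

lemma sPlusL_antisymmDouble_cons (j c : ℤ) (r : List ℤ) :
    sPlusL j (antisymmDouble (c :: r)) =
      sPlusL j (r.reverse.map fun x => -x) ++ (sPlusL j [-c, c] ++ sPlusL j r) := by
  rw [← sPlusL_append, ← sPlusL_append]
  simp [antisymmDouble]

lemma sPlusL_antisymmDouble_neg_cons {j : ℤ} (hj : 0 ≤ j) (c : ℤ) (r : List ℤ) :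
    sPlusL j (antisymmDouble (-c :: r)) = sPlusL j (antisymmDouble (c :: r)) := by
  rw [sPlusL_antisymmDouble_cons, sPlusL_antisymmDouble_cons, neg_neg]
  congr 2
  simp only [sPlusL_cons, sPlusL_nil, List.append_nil]
  split_ifs <;> first | omega | rfl

/-- Replacing the last entry `y` by `1 - y` changes at most the last letter of the word. -/
lemma dropLast_descend_fold {T : ℤ → List Step} {y : ℤ} {m : ℕ} (hy : y ≤ 0) (hym : 1 - y < m) :
    (descend (fun j => sPlusL j [-(1 - y)] ++ (T j ++ sPlusL j [1 - y])) 0 m).dropLast =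
      (descend (fun j => sPlusL j [-y] ++ (T j ++ sPlusL j [y])) 0 m).dropLast := by
  obtain ⟨m, rfl⟩ : ∃ k, m = k + 1 := ⟨m - 1, by omega⟩
  have hleft : descend (fun j => sPlusL j [-(1 - y)] ++ (T j ++ sPlusL j [1 - y])) 0 (m + 1) =
      descend (fun j => sPlusL (j + 1) [1 - y] ++ T j) 0 (m + 1) ++ sPlusL 0 [1 - y] := by
    rw [← descend_append_shift T (fun j => sPlusL j [1 - y])]
    have htop : sPlusL (0 + (m + 1 : ℕ)) [1 - y] = [] := by
      rw [sPlusL_cons, if_neg (by omega), if_neg (by omega), sPlusL_nil]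
      rfl
    simp only [htop, List.nil_append]
    refine descend_congr _ fun j hj => ?_
    rw [sPlusL_cons, if_neg (by omega), if_neg (by omega), sPlusL_nil]
    rfl
  have hshift : ∀ j, sPlusL j [-y] = sPlusL (j + 1) [1 - y] := fun j => by
    simp only [sPlusL_cons, sPlusL_nil, List.append_nil]
    split_ifs <;> first | omega | rfl
  have hright : descend (fun j => sPlusL j [-y] ++ (T j ++ sPlusL j [y])) 0 (m + 1) =
      descend (fun j => sPlusL (j + 1) [1 - y] ++ T j) 0 (m + 1) ++ sPlusL 0 [y] := by
    refine descend_append_bottom _ _ _ _ _ (fun j hj => ?_) ?_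
    · have : sPlusL j [y] = [] := by
        rw [sPlusL_cons, if_neg (by omega), if_neg (by omega), sPlusL_nil]
        rfl
      rw [this, hshift, List.append_nil]
    · simp [hshift]
  rw [hleft, hright]
  simp only [sPlusL_cons, sPlusL_nil, List.append_nil]
  rcases hy.lt_or_eq with h | rfl
  · rw [if_neg (by omega), if_neg (by omega), if_neg (by omega), if_neg (by omega)]
  · simp

lemma dropLast_descend_eq {u c v y : ℤ} {r : List ℤ} {m : ℕ} (hu : u = c ∨ u = -c)
    (hv : v = y ∨ v = 1 - y) (hy : y ≤ 0) (hym : 1 - y < m) :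
    (descend (fun j => sPlusL j (antisymmDouble (u :: r ++ [v]))) 0 m).dropLast =
      (descend (fun j => sPlusL j (antisymmDouble (c :: r ++ [y]))) 0 m).dropLast := by
  have hsplit : ∀ (j : ℤ) (a : List ℤ) (z : ℤ), sPlusL j (antisymmDouble (a ++ [z])) =
      sPlusL j [-z] ++ (sPlusL j (antisymmDouble a) ++ sPlusL j [z]) := fun j a z => by
    rw [antisymmDouble_append_singleton, ← sPlusL_append, ← sPlusL_append]
    rfl
  have hmid : ∀ j, 0 ≤ j →
      sPlusL j (antisymmDouble (u :: r)) = sPlusL j (antisymmDouble (c :: r)) := by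
    intro j hj
    rcases hu with rfl | rfl
    · rfl
    · exact sPlusL_antisymmDouble_neg_cons hj c r
  have hfirst : (descend (fun j => sPlusL j (antisymmDouble (u :: r ++ [v]))) 0 m) =
      descend (fun j => sPlusL j [-v] ++ (sPlusL j (antisymmDouble (c :: r)) ++ sPlusL j [v]))
        0 m :=
    descend_congr m fun j hj => by rw [hsplit, hmid j hj]
  simp only [hfirst, hsplit _ (c :: r) y]
  rcases hv with rfl | rfl
  · rfl
  · exact dropLast_descend_fold hy hym

/-! ### East steps before a North step -/

lemma ebn_le_succ (π : List Step) (k : ℕ) : ebn π k ≤ ebn π (k + 1) := by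
  induction π generalizing k with
  | nil => cases k <;> simp [ebn]
  | cons s π ih =>
    cases k with
    | zero => simp [ebn]
    | succ k =>
      cases s
      · exact ih k
      · exact Nat.succ_le_succ (ih (k + 1))

lemma ebn_le_count (π : List Step) (k : ℕ) : ebn π k ≤ π.count Step.E := by
  induction π generalizing k with
  | nil => cases k <;> simp [ebn]
  | cons s π ih =>
    cases k with
    | zero => simp [ebn]
    | succ k => cases s <;> simp [ebn, ih]

lemma eq_of_ebn_eq {π ρ : List Step} (hN : π.count Step.N = ρ.count Step.N)
    (hE : π.count Step.E = ρ.count Step.E)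
    (h : ∀ k, 1 ≤ k → k ≤ π.count Step.N → ebn π k = ebn ρ k) : π = ρ := by
  induction π generalizing ρ with
  | nil =>
    cases ρ with
    | nil => rfl
    | cons t ρ => cases t <;> simp at hN hE
  | cons s π ih =>
    cases ρ with
    | nil => cases s <;> simp at hN hE
    | cons t ρ =>
      cases s <;> cases t
      · congr 1
        refine ih (by simpa using hN) (by simpa using hE) fun k hk hk' => ?_
        exact h (k + 1) (by omega) (by simpa using hk')
      · have := h 1 le_rfl (by simp)
        simp [ebn] at this
      · have := h 1 le_rfl (by simp [hN])
        simp [ebn] at this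
      · congr 1
        refine ih (by simpa using hN) (by simpa using hE) fun k hk hk' => ?_
        obtain ⟨k, rfl⟩ : ∃ l, k = l + 1 := ⟨k - 1, by omega⟩
        simpa [ebn] using h (k + 1) hk (by simpa using hk')

/-! ### Representatives of area vectors -/

/-- The entries of the area vector up to the symmetries `a₁ ↦ -a₁` and `aₙ ↦ 1 - aₙ`
(0-based index), normalized so that `0 ≤ a₁` and `aₙ ≤ 0`. -/
def normArea (n : ℕ) (π : List Step) (k : ℕ) : ℤ :=
  if k + 1 = n then
    min (2 * (ebn π n : ℤ) - ebn π (n - 1)) (2 * n - 1 - (2 * (ebn π n : ℤ) - ebn π (n - 1))) -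
      (n - 1)
  else (ebn π (k + 1) : ℤ) - k

/-- The list of all entries of `normArea`. -/
def normAreaList (n : ℕ) (π : List Step) : List ℤ := (List.range n).map (normArea n π)

lemma range_map_eq_cons_append {α : Type*} (f : ℕ → α) (k : ℕ) :
    (List.range (k + 2)).map f =
      f 0 :: (List.range k).map (fun i => f (i + 1)) ++ [f (k + 1)] := by
  rw [List.range_succ, List.range_succ_eq_map]
  simp [Function.comp_def]

lemma normArea_bounds {n : ℕ} {π : List Step} (hE : π.count Step.E = n - 1) {k : ℕ}
    (hk : k < n) : -(n : ℤ) < normArea n π k ∧ normArea n π k < n := by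
  have h1 := ebn_le_count π (k + 1)
  have h2 := ebn_le_count π n
  have h3 := ebn_le_succ π (n - 1)
  rw [show n - 1 + 1 = n by omega] at h3
  unfold normArea
  split_ifs <;> omega

lemma normArea_last_nonpos (n : ℕ) (π : List Step) (k : ℕ) (hk : k + 1 = n) :
    normArea n π k ≤ 0 := by
  rw [normArea, if_pos hk]
  omega

lemma normAreaList_slowDescent {n : ℕ} {π : List Step} (hE : π.count Step.E = n - 1) :
    SlowDescent (normAreaList n π) := by
  rw [SlowDescent, List.isChain_iff_getElem]
  intro i hi
  simp only [normAreaList, List.length_map, List.length_range] at hi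
  simp only [normAreaList, List.getElem_map, List.getElem_range]
  have h1 := ebn_le_succ π (i + 1)
  have h2 := ebn_le_count π n
  unfold normArea
  rw [if_neg (by omega)]
  split_ifs with h
  · subst h
    simp only [Nat.add_sub_cancel]
    omega
  · omega

lemma normAreaList_head_nonneg {n : ℕ} (hn : 2 ≤ n) (π : List Step) :
    ∀ x ∈ (normAreaList n π).head?, 0 ≤ x := by
  obtain ⟨k, rfl⟩ : ∃ k, n = k + 2 := ⟨n - 2, by omega⟩
  rw [normAreaList, range_map_eq_cons_append]
  simp [normArea]

lemma antisymmDouble_normAreaList_getLast {n : ℕ} (hn : 2 ≤ n) (π : List Step) :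
    ∀ x ∈ (antisymmDouble (normAreaList n π)).getLast?, x ≤ 0 := by
  obtain ⟨k, rfl⟩ : ∃ k, n = k + 2 := ⟨n - 2, by omega⟩
  rw [normAreaList, range_map_eq_cons_append, antisymmDouble, ← List.append_assoc,
    List.getLast?_append]
  simpa using normArea_last_nonpos _ π _ rfl

lemma antisymmDouble_normAreaList_slowDescent {n : ℕ} (hn : 2 ≤ n) {π : List Step}
    (hE : π.count Step.E = n - 1) : SlowDescent (antisymmDouble (normAreaList n π)) :=
  antisymmDouble_slowDescent (normAreaList_slowDescent hE) (normAreaList_head_nonneg hn π)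

lemma antisymmDouble_normAreaList_lt {n : ℕ} {π : List Step} (hE : π.count Step.E = n - 1) :
    ∀ x ∈ antisymmDouble (normAreaList n π), x < 0 + (2 * n : ℕ) := by
  intro x hx
  rw [antisymmDouble, List.mem_append] at hx
  simp only [normAreaList, List.mem_map, List.mem_reverse, List.mem_range] at hx
  rcases hx with ⟨-, ⟨k, hk, rfl⟩, rfl⟩ | ⟨k, hk, rfl⟩ <;>
  · have := normArea_bounds hE hk
    omega

lemma normAreaList_injOn {n : ℕ} (hn : 2 ≤ n) {π ρ : List Step}
    (hπ : IsLatticePath (n - 1) n π) (hρ : IsLatticePath (n - 1) n ρ)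
    (h : normAreaList n π = normAreaList n ρ) : π = ρ := by
  have hk : ∀ k < n, normArea n π k = normArea n ρ k := fun k hk =>
    List.map_inj_left.1 h k (List.mem_range.2 hk)
  have hlow : ∀ k, 1 ≤ k → k < n → ebn π k = ebn ρ k := by
    intro k h1 h2
    have := hk (k - 1) (by omega)
    rw [normArea, normArea, if_neg (by omega), if_neg (by omega),
      show k - 1 + 1 = k by omega] at this
    omega
  refine eq_of_ebn_eq (hπ.2.trans hρ.2.symm) (hπ.1.trans hρ.1.symm) fun k h1 h2 => ?_
  rw [hπ.2] at h2
  rcases h2.lt_or_eq with h2 | rfl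
  · exact hlow k h1 h2
  · have h3 := hk (k - 1) (by omega)
    have h4 := hlow (k - 1) (by omega) (by omega)
    rw [normArea, normArea, if_pos (by omega), if_pos (by omega)] at h3
    omega

/-! ### The zeta map through normalized area vectors -/

/-- The word read off from the normalized area vector, whose last letter is always `N`. -/
def zetaWord (n : ℕ) (π : List Step) : List Step :=
  descend (fun j => sPlusL j (antisymmDouble (normAreaList n π))) 0 (2 * n)

lemma zetaDraw_eq_dropLast_zetaWord {n : ℕ} (hn : 2 ≤ n) {π : SPath}
    (hE : π.path.count Step.E = n - 1) (hs : π.sgn = 1 ∨ π.sgn = -1) :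
    zetaDraw n π = (zetaWord n π.path).dropLast := by
  obtain ⟨k, rfl⟩ : ∃ k, n = k + 2 := ⟨n - 2, by omega⟩
  have hlevels := flatten_reverse_range_map
    (fun j => sPlusL j (antisymmDouble (areaDList (k + 2) π))) 0 (2 * (k + 2))
  simp only [zero_add] at hlevels
  have hcast : ∀ l : List ℕ, (do let a ← l; pure (a : ℤ)) = l.map fun a : ℕ => (a : ℤ) := by
    intro l
    rw [List.map_eq_flatMap]
    rfl
  simp only [zetaDraw, zetaWord, sMinusR_append_sPlusL]
  rw [hcast, List.map_map, Function.comp_def, hlevels, areaDList, normAreaList,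
    range_map_eq_cons_append, range_map_eq_cons_append]
  have hmid : (List.range k).map (fun i => areaD (k + 2) π (i + 1 + 1)) =
      (List.range k).map fun i => normArea (k + 2) π.path (i + 1) := by
    refine List.map_congr_left fun i hi => ?_
    rw [List.mem_range] at hi
    rw [areaD, if_neg (by omega), if_neg (by omega), lamD, if_neg (by omega), if_neg (by omega),
      normArea, if_neg (by omega)]
    push_cast
    ring
  rw [hmid]
  refine dropLast_descend_eq ?_ ?_ (normArea_last_nonpos _ _ _ rfl) ?_
  · rw [areaD, if_pos (zero_add 1), lamD, if_pos rfl, normArea,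
      if_neg (show ¬0 + 1 = k + 2 by omega)]
    rcases hs with hs | hs <;> rw [hs] <;> split_ifs <;> push_cast <;> omega
  · have h1 : ¬k + 1 + 1 = 1 := by omega
    have h2 : k + 1 + 1 = k + 2 := rfl
    rw [areaD, if_neg h1, if_pos h2, lamD, if_neg (show ¬k + 2 = 1 by omega),
      if_pos rfl, normArea, if_pos h2]
    split_ifs <;> push_cast <;> omega
  · have := normArea_bounds hE (k := k + 1) (by omega)
    push_cast at this ⊢
    omega

lemma length_zetaWord {n : ℕ} {π : List Step} (hE : π.count Step.E = n - 1) :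
    (zetaWord n π).length = 2 * n := by
  rw [zetaWord, length_descend_antisymmDouble]
  · simp [normAreaList]
  · intro x hx
    simp only [normAreaList, List.mem_map, List.mem_range] at hx
    obtain ⟨k, hk, rfl⟩ := hx
    have := normArea_bounds hE hk
    push_cast
    omega

lemma isBallotPath_dropLast_zetaWord {n : ℕ} {π : List Step} (hE : π.count Step.E = n - 1) :
    IsBallotPath (2 * n - 1) (zetaWord n π).dropLast := by
  refine ⟨by rw [List.length_dropLast, length_zetaWord hE], fun k => ?_⟩
  rw [List.dropLast_eq_take, List.take_take]
  exact count_take_descend_le (antisymmDouble_normAreaList_lt hE) _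

lemma zetaWord_getLast {n : ℕ} (hn : 2 ≤ n) {π : List Step} (hE : π.count Step.E = n - 1) :
    (zetaWord n π).getLast? = some Step.N := by
  refine (descend_getLast (antisymmDouble_normAreaList_slowDescent hn hE)
    (antisymmDouble_normAreaList_getLast hn π) _).resolve_left fun h => ?_
  have := length_zetaWord hE
  rw [zetaWord, h] at this
  simp at this
  omega

lemma dropLast_zetaWord_injOn {n : ℕ} (hn : 2 ≤ n) {π ρ : List Step}
    (hπ : IsLatticePath (n - 1) n π) (hρ : IsLatticePath (n - 1) n ρ)
    (h : (zetaWord n π).dropLast = (zetaWord n ρ).dropLast) : π = ρ := by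
  have hword : zetaWord n π = zetaWord n ρ := by
    rw [← List.dropLast_append_getLast? _ (zetaWord_getLast hn hπ.1),
      ← List.dropLast_append_getLast? _ (zetaWord_getLast hn hρ.1), h]
  have hcount : ∀ {σ : List Step}, σ.count Step.E = n - 1 →
      (zetaWord n σ).count Step.N =
        (zetaWord n σ).count Step.E + (antisymmDouble (normAreaList n σ)).count 0 := by
    intro σ hσ
    have h1 := count_descend (antisymmDouble (normAreaList n σ)) 0 (2 * n)
    rwa [List.count_eq_zero.2 fun hmem =>
      lt_irrefl _ (antisymmDouble_normAreaList_lt hσ _ hmem), add_zero] at h1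
  refine normAreaList_injOn hn hπ hρ ?_
  refine antisymmDouble_injective_of_sPlusL (antisymmDouble_normAreaList_slowDescent hn hπ.1)
    (antisymmDouble_normAreaList_slowDescent hn hρ.1) fun j hj => ?_
  rcases lt_or_ge j (0 + (2 * n : ℕ)) with hjn | hjn
  · refine sPlusL_eq_of_descend_eq (antisymmDouble_normAreaList_slowDescent hn hπ.1)
      (antisymmDouble_normAreaList_slowDescent hn hρ.1)
      (antisymmDouble_normAreaList_getLast hn π) (antisymmDouble_normAreaList_getLast hn ρ)
      hword ?_ hj hjn
    have h1 := hcount hπ.1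
    rw [hword, hcount hρ.1] at h1
    omega
  · have hnil : ∀ {σ : List Step}, σ.count Step.E = n - 1 →
        sPlusL j (antisymmDouble (normAreaList n σ)) = [] := fun hσ =>
      sPlusL_eq_nil fun c hc => (antisymmDouble_normAreaList_lt hσ c hc).trans_le hjn
    rw [hnil hπ.1, hnil hρ.1]

/-! ### Ballot paths are not more numerous than lattice paths -/

/-- The number of North steps minus the number of East steps. -/
def height (w : List Step) : ℤ := (w.count Step.N : ℤ) - w.count Step.E

/-- An injection from paths that stay weakly above height `-h` to paths whose final height lies
in `[-h, h + 1]`. -/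
def ballotToLattice : ℤ → List Step → List Step
  | _, [] => []
  | h, Step.N :: w =>
    (if height (ballotToLattice (h + 1) w) ≤ h then Step.N else Step.E) ::
      ballotToLattice (h + 1) w
  | h, Step.E :: w => Step.E :: ballotToLattice (h - 1) w

lemma length_ballotToLattice (h : ℤ) (w : List Step) :
    (ballotToLattice h w).length = w.length := by
  induction w generalizing h with
  | nil => rfl
  | cons s w ih => cases s <;> simp [ballotToLattice, ih]

lemma height_nil : height [] = 0 := rfl

lemma height_cons_N (w : List Step) : height (Step.N :: w) = height w + 1 := by
  simp [height]
  ring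

lemma height_cons_E (w : List Step) : height (Step.E :: w) = height w - 1 := by
  simp [height]
  ring

/-- The path `w` started at height `h` never goes below height `0`. -/
def StaysNonneg (h : ℤ) (w : List Step) : Prop := ∀ k, 0 ≤ h + height (w.take k)

lemma StaysNonneg.nonneg {h : ℤ} {w : List Step} (hw : StaysNonneg h w) : 0 ≤ h := by
  simpa [height] using hw 0

lemma StaysNonneg.of_cons_N {h : ℤ} {w : List Step} (hw : StaysNonneg h (Step.N :: w)) :
    StaysNonneg (h + 1) w := fun k => by
  have := hw (k + 1)
  rw [List.take_succ_cons, height_cons_N] at this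
  omega

lemma StaysNonneg.of_cons_E {h : ℤ} {w : List Step} (hw : StaysNonneg h (Step.E :: w)) :
    StaysNonneg (h - 1) w := fun k => by
  have := hw (k + 1)
  rw [List.take_succ_cons, height_cons_E] at this
  omega

lemma height_ballotToLattice {h : ℤ} {w : List Step} (hw : StaysNonneg h w) :
    -h ≤ height (ballotToLattice h w) ∧ height (ballotToLattice h w) ≤ h + 1 := by
  induction w generalizing h with
  | nil =>
    have := hw.nonneg
    rw [ballotToLattice, height_nil]
    omega
  | cons s w ih =>
    have h0 := hw.nonneg
    cases s
    · have := ih hw.of_cons_N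
      rw [ballotToLattice]
      split_ifs
      · rw [height_cons_N]; omega
      · rw [height_cons_E]; omega
    · have := ih hw.of_cons_E
      rw [ballotToLattice, height_cons_E]
      omega

lemma ballotToLattice_injOn {h : ℤ} {v w : List Step} (hv : StaysNonneg h v)
    (hw : StaysNonneg h w) (heq : ballotToLattice h v = ballotToLattice h w) : v = w := by
  have key : ∀ {h : ℤ} {v w : List Step}, StaysNonneg h (Step.E :: w) →
      ballotToLattice h (Step.N :: v) ≠ ballotToLattice h (Step.E :: w) := by
    intro h v w hw heq
    rw [ballotToLattice, ballotToLattice, List.cons.injEq] at heq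
    have := height_ballotToLattice hw.of_cons_E
    rw [← heq.2] at this
    rw [if_pos (by omega)] at heq
    exact Step.noConfusion heq.1
  induction v generalizing h w with
  | nil =>
    have := congrArg List.length heq
    rw [length_ballotToLattice, length_ballotToLattice] at this
    exact (List.length_eq_zero_iff.1 this.symm).symm
  | cons s v ih =>
    cases w with
    | nil =>
      have := congrArg List.length heq
      rw [length_ballotToLattice, length_ballotToLattice] at this
      simp at this
    | cons t w =>
      cases s <;> cases t
      · rw [ballotToLattice, ballotToLattice, List.cons.injEq] at heq
        rw [ih hv.of_cons_N hw.of_cons_N heq.2]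
      · exact absurd heq (key hw)
      · exact absurd heq.symm (key hv)
      · rw [ballotToLattice, ballotToLattice, List.cons.injEq] at heq
        rw [ih hv.of_cons_E hw.of_cons_E heq.2]

lemma finite_length_eq_step (m : ℕ) : {w : List Step | w.length = m}.Finite := by
  have : Finite Step := Finite.of_injective (fun s => decide (s = Step.N)) fun s t hst => by
    cases s <;> cases t <;> simp_all
  exact List.finite_length_eq Step m

lemma ncard_isBallotPath_le {n : ℕ} (hn : 1 ≤ n) :
    {β : List Step | IsBallotPath (2 * n - 1) β}.ncard ≤
      {π : List Step | IsLatticePath (n - 1) n π}.ncard := by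
  have hstays : ∀ {β}, IsBallotPath (2 * n - 1) β → StaysNonneg 0 β := fun hβ k => by
    have := hβ.2 k
    unfold height
    omega
  refine Set.ncard_le_ncard_of_injOn (ballotToLattice 0) (fun β hβ => ?_)
    (fun β hβ γ hγ h => ballotToLattice_injOn (hstays hβ) (hstays hγ) h)
    ((finite_length_eq_step (2 * n - 1)).subset fun π hπ => ?_)
  · have h1 := height_ballotToLattice (hstays hβ)
    have h2 := length_ballotToLattice 0 β
    rw [hβ.1, length_eq_count_add_count] at h2
    unfold height at h1
    change _ ∧ _
    omega
  · have := hπ.1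
    have := hπ.2
    change π.length = _
    rw [length_eq_count_add_count]
    omega

/-- The map `ζ_D* : L_{n-1,n} → B_{2n-1}`, `π* ↦ (ζ_D(π))*`, is well
defined (the underlying path of `ζ_D(π)` depends only on the underlying path of `π`) and
is a bijection from lattice paths with `n-1` East and `n` North steps onto ballot paths
of length `2n-1`. -/
theorem zetaDstar_bijOn (n : ℕ) (hn : 2 ≤ n) :
    (∀ π ρ : SPath, IsSignedLatticePath n π → IsSignedLatticePath n ρ →
      π.path = ρ.path → (zetaD n π).path = (zetaD n ρ).path) ∧
    Set.BijOn (fun π : List Step => (zetaD n { path := π, sgn := 1 }).path)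
      {π : List Step | IsLatticePath (n - 1) n π}
      {β : List Step | IsBallotPath (2 * n - 1) β} := by
  have hpath : ∀ {π : SPath}, IsSignedLatticePath n π →
      (zetaD n π).path = (zetaWord n π.path).dropLast := fun hπ =>
    zetaDraw_eq_dropLast_zetaWord hn hπ.1.1 hπ.2.1
  refine ⟨fun π ρ hπ hρ h => by rw [hpath hπ, hpath hρ, h], ?_⟩
  have heq : Set.EqOn (fun π => (zetaWord n π).dropLast)
      (fun π : List Step => (zetaD n { path := π, sgn := 1 }).path)
      {π : List Step | IsLatticePath (n - 1) n π} := fun π hπ =>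
    (hpath (π := { path := π, sgn := 1 }) ⟨hπ, Or.inl rfl, fun _ => rfl⟩).symm
  refine Set.BijOn.congr ?_ heq
  have hmaps : Set.MapsTo (fun π => (zetaWord n π).dropLast)
      {π : List Step | IsLatticePath (n - 1) n π}
      {β : List Step | IsBallotPath (2 * n - 1) β} := fun π hπ =>
    isBallotPath_dropLast_zetaWord hπ.1
  have hinj : Set.InjOn (fun π => (zetaWord n π).dropLast)
      {π : List Step | IsLatticePath (n - 1) n π} := fun π hπ ρ hρ h =>
    dropLast_zetaWord_injOn hn hπ hρ h
  refine ⟨hmaps, hinj, ?_⟩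
  have hfin : {β : List Step | IsBallotPath (2 * n - 1) β}.Finite :=
    (finite_length_eq_step _).subset fun β hβ => hβ.1
  refine (Set.eq_of_subset_of_ncard_le hmaps.image_subset ?_ hfin).ge
  rw [hinj.ncard_image]
  exact ncard_isBallotPath_le (by omega)
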